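/- Under the hypotheses of the main pushforward theorem (S a ℚ-algebra, φ: S → R, W ∈ S, X a finite rank matrix factorisation of φ(W) with homogeneous basis, t = (t₁,…,tₙ) quasi-regular with R/tR finitely generated projective over S, homotopies λⱼ with λⱼd_X + d_Xλⱼ = tⱼ·1_X, and a standard flat S-linear connection ∇⁰ on R over S[t] with Ker(∇⁰) + tR = R), the idempotent e on X/tX corresponding to the summand φ_*(X)[n] is given, as an S-linear endomorphism of X/tX, by e = (1/n!)·(−1)^{n(n−1)/2}· Σ_{τ∈Sₙ} sgn(τ) · λ₁⋯λₙ · [∂_{τ(1)}, d_X]⋯[∂_{τ(n)}, d_X], where ∂ⱼ = ∂/∂tⱼ = (dtⱼ)*∘∇⁰ extended over the basis of X, and each commutator [∂ⱼ, d_X] is S[t]-linear on X and so induces an S-linear map on X/tX. -/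

import Mathlib

/-!
STATEMENT 12 (the idempotent of the main pushforward theorem, expanded form).

Conventions.  A finite rank matrix factorisation `X` of `φ(W)` over `R` with fixed
homogeneous basis is `ι → R` with parity function `par`; grading involution `gX`, odd
maps anticommute with it, `d² = φ(W)·1`.  `X/tX = ι → R/tR`, with differential and
grading the reductions of `d` and `gX`; `φ_*(X)[n]` is `ι → R` viewed over `S`, with
differential `(-1)ⁿd` and grading `(-1)ⁿgX`.  Morphisms in the homotopy category are
even `S`-linear chain maps up to homotopy (`f ≃ g` iff `f - g = Dh + hD`).  `S[t]` maps
to `R` by `tᵢ ↦ u i`; a connection is encoded by components `∂ⱼ : R →ₗ[S] R` (Leibniz: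
`∂ⱼ(uᵢ r) = uᵢ∂ⱼr + δᵢⱼ r`, flat: the `∂ⱼ` commute), `δ∇⁰ = Σᵢ uᵢ∂ᵢ`; standard means
`p·1 + δ∇⁰` is bijective and identifies `tR` with `tR` for `p > 0` and `Im(δ∇⁰) = tR`.
The operators `∂ⱼ` extend componentwise over the basis of `X`, the commutators
`[∂ⱼ, d_X]` are `S[t]`-linear and descend to `S`-linear endomorphisms of `X/tX`; they
are built from the descended commutators `C j a` characterised below (unique since the
quotient map is surjective).  Quasi-regularity is the classical coefficient condition.
-/

namespace Stmt12

def IsQuasiRegular {R : Type*} [CommRing R] {n : ℕ} (u : Fin n → R) : Prop :=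
  ∀ (k : ℕ) (F : MvPolynomial (Fin n) R), F.IsHomogeneous k →
    MvPolynomial.eval u F ∈ (Ideal.span (Set.range u)) ^ (k + 1) →
    ∀ m, MvPolynomial.coeff m F ∈ Ideal.span (Set.range u)

def gX (R : Type*) [CommRing R] {ι : Type*} [Fintype ι] [DecidableEq ι]
    (par : ι → Bool) : Module.End R (ι → R) :=
  LinearMap.pi fun i => (if par i then (-1 : R) else 1) • LinearMap.proj i

def dmat {R : Type*} [CommRing R] {ι : Type*} [Fintype ι] [DecidableEq ι]
    (d : Module.End R (ι → R)) (a b : ι) : R :=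
  d (Pi.single b 1) a

def matExt {R M : Type*} [CommRing R] [AddCommGroup M] [Module R M]
    {ι : Type*} [Fintype ι] [DecidableEq ι] (A : ι → ι → R) :
    (ι → M) →ₗ[R] (ι → M) :=
  LinearMap.pi fun a => ∑ b, A a b • LinearMap.proj b

/-- `δ∇⁰ = Σᵢ uᵢ·∂ᵢ` on `R`. -/
def delNabla0 {S R : Type*} [CommRing S] [CommRing R] [Algebra S R] {n : ℕ}
    (u : Fin n → R) (dd : Fin n → (R →ₗ[S] R)) : R →ₗ[S] R :=
  ∑ i : Fin n, LinearMap.mulLeft S (u i) ∘ₗ dd i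

end Stmt12

namespace Koszul

variable {S : Type*} [CommRing S] {n : ℕ}
  {V : Type*} [AddCommGroup V] [Module S V] {V' : Type*} [AddCommGroup V'] [Module S V']

theorem sum_sum_eq_zero_of_antisymm {ι M : Type*} [Fintype ι] [AddCommGroup M]
    (f : ι → ι → M) (hf : ∀ i j, f i j = -f j i) (h0 : ∀ i, f i i = 0) :
    ∑ i, ∑ j, f i j = 0 := by
  rw [← Fintype.sum_prod_type']
  refine Finset.sum_involution (fun x _ => x.swap) (fun x _ => ?_) (fun x _ hx h => hx ?_)
    (fun _ _ => Finset.mem_univ _) fun x _ => x.swap_swap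
  · rw [hf x.1 x.2]; exact neg_add_cancel _
  · rw [show x.2 = x.1 from congrArg Prod.fst h]; exact h0 _

/-- The sign picked up by moving the `i`-th generator past the smaller elements of `A`. -/
def sgn (i : Fin n) (A : Finset (Fin n)) : ℤ := (-1) ^ (A.filter (· < i)).card

/-- Exterior multiplication by the `i`-th generator on `V ⊗ ⋀ Sⁿ`, modelled on
`Finset (Fin n) → V`. -/
def create (i : Fin n) : Module.End S (Finset (Fin n) → V) :=
  LinearMap.pi fun A => if i ∈ A then sgn i A • LinearMap.proj (A.erase i) else 0

/-- Contraction with the `i`-th dual generator. -/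
def annih (i : Fin n) : Module.End S (Finset (Fin n) → V) :=
  LinearMap.pi fun A => if i ∈ A then 0 else sgn i A • LinearMap.proj (insert i A)

/-- The parity of the exterior degree. -/
def parity : Module.End S (Finset (Fin n) → V) :=
  LinearMap.pi fun A => ((-1) ^ A.card : ℤ) • LinearMap.proj A

/-- Componentwise action of an endomorphism of `V`. -/
def coeff : Module.End S V →+* Module.End S (Finset (Fin n) → V) where
  toFun f := f.compLeft _
  map_one' := rfl
  map_mul' _ _ := rfl
  map_zero' := rfl
  map_add' _ _ := rfl

theorem create_apply (i : Fin n) (m : Finset (Fin n) → V) (A : Finset (Fin n)) :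
    create (S := S) i m A = if i ∈ A then sgn i A • m (A.erase i) else 0 := by
  simp only [create, LinearMap.pi_apply]; split_ifs <;> rfl

theorem annih_apply (i : Fin n) (m : Finset (Fin n) → V) (A : Finset (Fin n)) :
    annih (S := S) i m A = if i ∈ A then 0 else sgn i A • m (insert i A) := by
  simp only [annih, LinearMap.pi_apply]; split_ifs <;> rfl

theorem parity_apply (m : Finset (Fin n) → V) (A : Finset (Fin n)) :
    parity (S := S) m A = ((-1) ^ A.card : ℤ) • m A := rfl

theorem coeff_apply (f : Module.End S V) (m : Finset (Fin n) → V) (A : Finset (Fin n)) :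
    coeff f m A = f (m A) := rfl

theorem sgn_mul_self (i : Fin n) (A : Finset (Fin n)) : sgn i A * sgn i A = 1 := by
  rw [sgn, ← mul_pow]; simp

theorem sgn_insert {i j : Fin n} {A : Finset (Fin n)} (hj : j ∉ A) :
    sgn i (insert j A) = if j < i then -sgn i A else sgn i A := by
  unfold sgn
  rw [Finset.filter_insert]
  split_ifs
  · rw [Finset.card_insert_of_notMem (by simp [hj]), pow_succ]; simp
  · rfl

theorem sgn_erase {i j : Fin n} {A : Finset (Fin n)} (hj : j ∈ A) :
    sgn i (A.erase j) = if j < i then -sgn i A else sgn i A := by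
  conv_rhs => rw [← Finset.insert_erase hj]
  rw [sgn_insert (Finset.notMem_erase j A)]
  split_ifs <;> simp

theorem create_mul_create (i j : Fin n) :
    create i * create j = -(create j * create i : Module.End S (Finset (Fin n) → V)) := by
  refine LinearMap.ext fun m => funext fun A => ?_
  simp only [Module.End.mul_apply, LinearMap.neg_apply, Pi.neg_apply, create_apply]
  by_cases hij : i = j
  · subst hij; simp
  by_cases hi : i ∈ A <;> by_cases hj : j ∈ A <;>
    simp only [hi, hj, Finset.mem_erase, ne_eq, hij, Ne.symm hij, not_false_eq_true, and_self,
      if_true, if_false, and_false, smul_zero, neg_zero, Finset.erase_right_comm (a := i),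
      sgn_erase, smul_smul]
  rw [← neg_smul]
  congr 1
  rcases lt_or_gt_of_ne hij with h | h <;> simp [h, not_lt_of_gt h, mul_comm]

theorem create_mul_self (i : Fin n) :
    create i * create i = (0 : Module.End S (Finset (Fin n) → V)) := by
  refine LinearMap.ext fun m => funext fun A => ?_
  simp [create_apply]

theorem annih_mul_annih (i j : Fin n) :
    annih i * annih j = -(annih j * annih i : Module.End S (Finset (Fin n) → V)) := by
  refine LinearMap.ext fun m => funext fun A => ?_
  simp only [Module.End.mul_apply, LinearMap.neg_apply, Pi.neg_apply, annih_apply]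
  by_cases hij : i = j
  · subst hij; simp
  by_cases hi : i ∈ A <;> by_cases hj : j ∈ A <;>
    simp only [hi, hj, Finset.mem_insert, hij, Ne.symm hij, or_self, or_true,
      if_true, if_false, smul_zero, neg_zero, Finset.insert_comm i j, not_false_eq_true,
      sgn_insert, smul_smul]
  rw [← neg_smul]
  congr 1
  rcases lt_or_gt_of_ne hij with h | h <;> simp [h, not_lt_of_gt h, mul_comm]

theorem annih_mul_self (i : Fin n) :
    annih i * annih i = (0 : Module.End S (Finset (Fin n) → V)) := by
  refine LinearMap.ext fun m => funext fun A => ?_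
  simp [annih_apply]

theorem create_mul_annih_self_apply (i : Fin n) (m : Finset (Fin n) → V)
    (A : Finset (Fin n)) :
    (create i * annih i : Module.End S _) m A = if i ∈ A then m A else 0 := by
  simp only [Module.End.mul_apply, annih_apply, create_apply]
  split_ifs with h <;> simp_all [sgn_erase, smul_smul, sgn_mul_self, Finset.insert_erase]

theorem annih_mul_create (i j : Fin n) :
    annih i * create j + create j * annih i =
      ((if i = j then 1 else 0 : Module.End S (Finset (Fin n) → V))) := by
  refine LinearMap.ext fun m => funext fun A => ?_
  rw [LinearMap.add_apply, Pi.add_apply]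
  by_cases hij : i = j
  · subst hij
    rw [create_mul_annih_self_apply]
    simp only [Module.End.mul_apply, annih_apply, create_apply]
    by_cases hi : i ∈ A <;>
      simp [hi, sgn_insert, smul_smul, sgn_mul_self]
  · simp only [Module.End.mul_apply, annih_apply, create_apply, hij, if_false,
      LinearMap.zero_apply, Pi.zero_apply]
    by_cases hi : i ∈ A <;> by_cases hj : j ∈ A <;>
      simp only [hi, hj, Finset.mem_insert, Finset.mem_erase, hij, Ne.symm hij, or_true,
        and_true, and_false, if_true, if_false, smul_zero, ne_eq, or_self, not_false_eq_true, sgn_insert,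
        sgn_erase, smul_smul, add_zero]
    rw [Finset.erase_insert_of_ne hij, ← add_smul]
    convert zero_smul ℤ _ using 2
    rcases lt_or_gt_of_ne hij with h | h <;> simp [h, not_lt_of_gt h, mul_comm]

theorem parity_mul_annih (i : Fin n) :
    parity * annih i = -(annih i * parity : Module.End S (Finset (Fin n) → V)) := by
  refine LinearMap.ext fun m => funext fun A => ?_
  simp only [Module.End.mul_apply, LinearMap.neg_apply, Pi.neg_apply, annih_apply,
    parity_apply]
  split_ifs with h
  · simp
  · rw [Finset.card_insert_of_notMem h, pow_succ, smul_smul, smul_smul, ← neg_smul]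
    congr 1; ring

theorem parity_mul_self : parity * parity = (1 : Module.End S (Finset (Fin n) → V)) := by
  refine LinearMap.ext fun m => funext fun A => ?_
  simp only [Module.End.mul_apply, parity_apply, smul_smul, ← mul_pow]
  simp

theorem commute_coeff_create (f : Module.End S V) (i : Fin n) :
    Commute (coeff f) (create i) := by
  refine LinearMap.ext fun m => funext fun A => ?_
  simp only [Module.End.mul_apply, create_apply, coeff_apply]
  split_ifs <;> simp

theorem commute_coeff_annih (f : Module.End S V) (i : Fin n) :
    Commute (coeff f) (annih i) := by
  refine LinearMap.ext fun m => funext fun A => ?_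
  simp only [Module.End.mul_apply, annih_apply, coeff_apply]
  split_ifs <;> simp

theorem commute_coeff_parity (f : Module.End S V) :
    Commute (coeff f) (parity : Module.End S (Finset (Fin n) → V)) := by
  refine LinearMap.ext fun m => funext fun A => ?_
  simp only [Module.End.mul_apply, parity_apply, coeff_apply, map_zsmul]

theorem compLeft_create (f : V →ₗ[S] V') (i : Fin n) (m : Finset (Fin n) → V) :
    f.compLeft _ (create (S := S) i m) = create (S := S) i (f.compLeft _ m) := by
  ext A
  simp only [create_apply, LinearMap.compLeft_apply, Function.comp_apply]
  split_ifs <;> simp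

theorem sum_create_mul_annih_apply (m : Finset (Fin n) → V) (A : Finset (Fin n)) :
    (∑ i, create i * annih i : Module.End S _) m A = A.card • m A := by
  simp only [LinearMap.sum_apply, Finset.sum_apply, create_mul_annih_self_apply]
  simp

theorem parity_mul_coeff_mul_parity_mul_coeff (f g : Module.End S V) :
    (coeff f * parity) * (coeff g * parity) =
      (coeff (f * g) : Module.End S (Finset (Fin n) → V)) := by
  rw [mul_assoc, ← mul_assoc parity, ← (commute_coeff_parity g).eq, mul_assoc,
    parity_mul_self, mul_one, map_mul]

/-- Extracts the coefficient of a product of creation operators. -/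
theorem prod_create_single_apply (l : List (Fin n)) (hl : l.Pairwise (· < ·)) (v : V) :
    (l.map (create (S := S))).prod (Pi.single ∅ v) l.toFinset = v := by
  induction l with
  | nil => simp
  | cons k l ih =>
    rw [List.pairwise_cons] at hl
    have hk : k ∉ l := fun h => lt_irrefl _ (hl.1 k h)
    rw [List.map_cons, List.prod_cons, Module.End.mul_apply, create_apply, if_pos (by simp),
      List.toFinset_cons, Finset.erase_insert (by simpa using hk), ih hl.2, sgn,
      Finset.filter_false_of_mem]
    · simp
    · intro j hj
      rw [Finset.mem_insert, List.mem_toFinset] at hj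
      rcases hj with rfl | hj
      · exact lt_irrefl _
      · exact (hl.1 j hj).not_gt

theorem prod_one_sub_single_apply_eq_zero (lam : Fin n → Module.End S V) (l : List (Fin n))
    (U A : Finset (Fin n)) (v : V) (j : Fin n) (hU : j ∈ U) (hA : j ∉ A) (hl : j ∉ l) :
    (l.map fun k => 1 - coeff (lam k) * parity * annih k : List (Module.End S _)).prod
      (Pi.single U v) A = 0 := by
  induction l generalizing A with
  | nil =>
    rw [List.map_nil, List.prod_nil, Module.End.one_apply, Pi.single_eq_of_ne]
    rintro rfl; exact hA hU
  | cons k l ih =>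
    simp only [List.mem_cons, not_or] at hl
    rw [List.map_cons, List.prod_cons, Module.End.mul_apply, LinearMap.sub_apply, Pi.sub_apply,
      Module.End.one_apply, ih A hA hl.2]
    simp only [Module.End.mul_apply, coeff_apply, parity_apply, annih_apply]
    split_ifs
    · simp
    · rw [ih _ (by simp [hl.1, hA]) hl.2]; simp

theorem prod_one_sub_single_apply (lam : Fin n → Module.End S V) (l : List (Fin n))
    (hl : l.Pairwise (· < ·)) (A : Finset (Fin n)) (hA : ∀ i ∈ A, ∀ j ∈ l, i < j) (v : V) :
    (l.map fun k => 1 - coeff (lam k) * parity * annih k : List (Module.End S _)).prod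
      (Pi.single (A ∪ l.toFinset) v) A = ((-1) ^ l.length : ℤ) • (l.map lam).prod v := by
  induction l generalizing A with
  | nil => simp
  | cons k l ih =>
    rw [List.pairwise_cons] at hl
    have hkl : k ∉ l := fun h => lt_irrefl _ (hl.1 k h)
    have hkA : k ∉ A := fun h => lt_irrefl _ (hA k h k (by simp))
    have hU : A ∪ (k :: l).toFinset = insert k A ∪ l.toFinset := by
      ext; simp
    have hs : sgn k A = (-1) ^ A.card := by
      rw [sgn, Finset.filter_true_of_mem fun i hi => hA i hi k (by simp)]
    rw [List.map_cons, List.prod_cons, Module.End.mul_apply, LinearMap.sub_apply, Pi.sub_apply,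
      Module.End.one_apply,
      prod_one_sub_single_apply_eq_zero lam l _ A v k (by simp) hkA hkl]
    simp only [Module.End.mul_apply, coeff_apply, parity_apply, annih_apply]
    rw [if_neg hkA, hU, ih hl.2 (insert k A), hs, smul_smul, ← mul_pow]
    · simp [pow_succ]
    · intro i hi j hj
      rw [Finset.mem_insert] at hi
      rcases hi with rfl | hi
      · exact hl.1 j hj
      · exact hA i hi j (by simp [hj])

/-- Products of creation operators as an alternating map. -/
def createAlternating (S : Type*) [CommRing S] (n : ℕ) (V : Type*) [AddCommGroup V] [Module S V] :
    (Fin n → S) [⋀^Fin n]→ₗ[S] Module.End S (Finset (Fin n) → V) :=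
  (ExteriorAlgebra.lift S ⟨Fintype.linearCombination S (create (S := S) (V := V)), by
    intro v
    simp only [Fintype.linearCombination_apply, Finset.sum_mul_sum, smul_mul_smul_comm]
    refine sum_sum_eq_zero_of_antisymm _ (fun i j => ?_) fun i => ?_
    · rw [create_mul_create, smul_neg, mul_comm]
    · rw [create_mul_self, smul_zero]⟩).toLinearMap.compAlternatingMap (ExteriorAlgebra.ιMulti S n)

theorem createAlternating_apply (r : Fin n → Fin n) :
    createAlternating S n V (fun j => Pi.single (r j) 1) =
      (List.ofFn fun j => create (r j)).prod := by
  simp [createAlternating, ExteriorAlgebra.ιMulti_apply, map_list_prod, List.map_ofFn, Function.comp_def]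

/-- A flat connection along commuting operators `u`, together with inverses of the
operators `p + ∑ᵢ uᵢ∂ᵢ` for `p > 0`. -/
structure Connection (S V : Type*) [CommRing S] [AddCommGroup V] [Module S V] (n : ℕ) where
  u : Fin n → Module.End S V
  del : Fin n → Module.End S V
  u_comm : ∀ i j, u i * u j = u j * u i
  del_comm : ∀ i j, del i * del j = del j * del i
  leibniz : ∀ i j, del j * u i = u i * del j + if i = j then 1 else 0
  inv : ℕ → Module.End S V
  inv_mul : ∀ p, 0 < p → inv p * (p • 1 + ∑ i, u i * del i) = 1
  mul_inv : ∀ p, 0 < p → (p • 1 + ∑ i, u i * del i) * inv p = 1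

namespace Connection

variable (K : Connection S V n)

/-- The Euler operator `∑ᵢ uᵢ∂ᵢ`. -/
def euler : Module.End S V := ∑ i, K.u i * K.del i

/-- The Koszul differential. -/
def koszul : Module.End S (Finset (Fin n) → V) := ∑ i, coeff (K.u i) * annih i

/-- The de Rham differential of the connection. -/
def nabla : Module.End S (Finset (Fin n) → V) := ∑ i, coeff (K.del i) * create i

/-- The Euler operator plus the exterior degree. -/
def totalEuler : Module.End S (Finset (Fin n) → V) :=
  coeff K.euler + ∑ i, create i * annih i

/-- The inverse of `totalEuler` in positive exterior degree, and zero in degree zero. -/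
def green : Module.End S (Finset (Fin n) → V) :=
  LinearMap.pi fun A => if A = ∅ then 0 else K.inv A.card ∘ₗ LinearMap.proj A

/-- The contracting homotopy of the Koszul complex. -/
def homotopy : Module.End S (Finset (Fin n) → V) := K.green * K.nabla

theorem koszul_mul_self : K.koszul * K.koszul = 0 := by
  rw [koszul, Finset.sum_mul_sum]
  have key : ∀ i j : Fin n, coeff (K.u i) * annih i * (coeff (K.u j) * annih j) =
      coeff (K.u i * K.u j) * (annih i * annih j) := fun i j => by
    rw [mul_assoc, ← mul_assoc (annih i), ← (commute_coeff_annih (K.u j) i).eq, map_mul]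
    simp only [mul_assoc]
  refine sum_sum_eq_zero_of_antisymm _ (fun i j => ?_) fun i => ?_
  · rw [key, key, annih_mul_annih, K.u_comm]
    exact mul_neg (α := Module.End S (Finset (Fin n) → V)) _ _
  · rw [key, annih_mul_self, mul_zero]

theorem nabla_mul_self : K.nabla * K.nabla = 0 := by
  rw [nabla, Finset.sum_mul_sum]
  have key : ∀ i j : Fin n, coeff (K.del i) * create i * (coeff (K.del j) * create j) =
      coeff (K.del i * K.del j) * (create i * create j) := fun i j => by
    rw [mul_assoc, ← mul_assoc (create i), ← (commute_coeff_create (K.del j) i).eq, map_mul]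
    simp only [mul_assoc]
  refine sum_sum_eq_zero_of_antisymm _ (fun i j => ?_) fun i => ?_
  · rw [key, key, create_mul_create, K.del_comm]
    exact mul_neg (α := Module.End S (Finset (Fin n) → V)) _ _
  · rw [key, create_mul_self, mul_zero]

theorem koszul_mul_nabla_add : K.koszul * K.nabla + K.nabla * K.koszul = K.totalEuler := by
  have key : ∀ i j : Fin n, coeff (K.u i) * annih i * (coeff (K.del j) * create j) +
      coeff (K.del j) * create j * (coeff (K.u i) * annih i) =
      if i = j then coeff (K.u i * K.del i) + create i * annih i else 0 := fun i j => by
    rw [mul_assoc, ← mul_assoc (annih i), ← (commute_coeff_annih (K.del j) i).eq,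
      mul_assoc (coeff (K.del j)) (create j), ← mul_assoc (create j),
      ← (commute_coeff_create (K.u i) j).eq,
      mul_assoc, ← mul_assoc (coeff (K.u i)), ← map_mul, mul_assoc (coeff (K.u i)) (create j),
      ← mul_assoc (coeff (K.del j)) (coeff (K.u i)), ← map_mul,
      K.leibniz, map_add, add_mul, ← add_assoc, ← mul_add, annih_mul_create]
    split_ifs with h
    · subst h; simp
    · simp
  rw [koszul, nabla, Finset.sum_mul_sum, Finset.sum_mul_sum,
    Finset.sum_comm (s := Finset.univ) (t := Finset.univ)
      (f := fun j i => coeff (K.del j) * create j * (coeff (K.u i) * annih i)),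
    ← Finset.sum_add_distrib]
  simp only [← Finset.sum_add_distrib, key, Finset.sum_ite_eq, Finset.mem_univ, if_true]
  rw [Finset.sum_add_distrib, totalEuler, euler, map_sum]

theorem totalEuler_mul_nabla : K.totalEuler * K.nabla = K.nabla * K.totalEuler := by
  rw [← koszul_mul_nabla_add, add_mul, mul_add, mul_assoc, nabla_mul_self, mul_zero, zero_add,
    ← mul_assoc K.nabla K.nabla, nabla_mul_self, zero_mul, add_zero, mul_assoc]

theorem totalEuler_mul_koszul : K.totalEuler * K.koszul = K.koszul * K.totalEuler := by
  rw [← koszul_mul_nabla_add, add_mul, mul_add, mul_assoc K.nabla, koszul_mul_self, mul_zero, add_zero,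
    ← mul_assoc K.koszul K.koszul, koszul_mul_self, zero_mul, zero_add, mul_assoc]

theorem totalEuler_apply (m : Finset (Fin n) → V) (A : Finset (Fin n)) :
    K.totalEuler m A = K.euler (m A) + A.card • m A := by
  rw [totalEuler, LinearMap.add_apply, Pi.add_apply, sum_create_mul_annih_apply, coeff_apply]

theorem green_apply (m : Finset (Fin n) → V) (A : Finset (Fin n)) :
    K.green m A = if A = ∅ then 0 else K.inv A.card (m A) := by
  simp only [green, LinearMap.pi_apply]; split_ifs <;> rfl

theorem inv_apply {p : ℕ} (hp : 0 < p) (v : V) : K.inv p (K.euler v + p • v) = v := by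
  simpa [euler, add_comm] using LinearMap.congr_fun (K.inv_mul p hp) v

theorem apply_inv {p : ℕ} (hp : 0 < p) (v : V) :
    K.euler (K.inv p v) + p • K.inv p v = v := by
  simpa [euler, add_comm] using LinearMap.congr_fun (K.mul_inv p hp) v

theorem totalEuler_green {m : Finset (Fin n) → V} (hm : m ∅ = 0) :
    K.totalEuler (K.green m) = m := by
  ext A
  rw [totalEuler_apply, green_apply]
  split_ifs with h
  · simp [h, hm]
  · exact K.apply_inv (Finset.card_pos.2 (Finset.nonempty_iff_ne_empty.2 h)) _

theorem green_totalEuler_apply (m : Finset (Fin n) → V) {A : Finset (Fin n)} (hA : A ≠ ∅) :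
    K.green (K.totalEuler m) A = m A := by
  rw [green_apply, if_neg hA, totalEuler_apply]
  exact K.inv_apply (Finset.card_pos.2 (Finset.nonempty_iff_ne_empty.2 hA)) _

theorem nabla_apply (m : Finset (Fin n) → V) (A : Finset (Fin n)) :
    K.nabla m A = ∑ i, if i ∈ A then sgn i A • K.del i (m (A.erase i)) else 0 := by
  simp only [nabla, LinearMap.sum_apply, Finset.sum_apply, Module.End.mul_apply, coeff_apply,
    create_apply]
  refine Finset.sum_congr rfl fun i _ => ?_
  split_ifs <;> simp

theorem koszul_apply (m : Finset (Fin n) → V) (A : Finset (Fin n)) :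
    K.koszul m A = ∑ i, if i ∈ A then 0 else sgn i A • K.u i (m (insert i A)) := by
  simp only [koszul, LinearMap.sum_apply, Finset.sum_apply, Module.End.mul_apply, coeff_apply,
    annih_apply]
  refine Finset.sum_congr rfl fun i _ => ?_
  split_ifs <;> simp

theorem nabla_apply_empty (m : Finset (Fin n) → V) : K.nabla m ∅ = 0 := by
  simp [nabla_apply]

theorem nabla_green_nabla (m : Finset (Fin n) → V) : K.nabla (K.green (K.nabla m)) = 0 := by
  ext A
  by_cases hA : A = ∅
  · subst hA; exact K.nabla_apply_empty _
  · rw [← K.green_totalEuler_apply (K.nabla (K.green (K.nabla m))) hA,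
      ← Module.End.mul_apply K.totalEuler, totalEuler_mul_nabla,
      Module.End.mul_apply, K.totalEuler_green (K.nabla_apply_empty m),
      ← Module.End.mul_apply K.nabla, nabla_mul_self]
    simp

theorem homotopy_mul_self : K.homotopy * K.homotopy = 0 := by
  refine LinearMap.ext fun m => ?_
  simp [homotopy, nabla_green_nabla]

theorem homotopy_apply_empty (m : Finset (Fin n) → V) : K.homotopy m ∅ = 0 := by
  simp [homotopy, green_apply]

theorem homotopy_apply_eq_zero {m : Finset (Fin n) → V} {A : Finset (Fin n)}
    (h : ∀ i ∈ A, m (A.erase i) = 0) : K.homotopy m A = 0 := by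
  rw [homotopy, Module.End.mul_apply, green_apply, nabla_apply, Finset.sum_eq_zero]
  · simp
  · intro i _
    split_ifs with hi
    · simp [h i hi]
    · rfl

/-- The degree zero part of the Koszul differential composed with the homotopy; it is the
projection onto the image of the `u i` along the flat sections. -/
def proj : Module.End S V := ∑ i, K.u i * K.inv 1 * K.del i

theorem koszul_homotopy_apply_empty (m : Finset (Fin n) → V) :
    K.koszul (K.homotopy m) ∅ = K.proj (m ∅) := by
  simp only [koszul_apply, Finset.notMem_empty, if_false, homotopy, Module.End.mul_apply,
    green_apply, nabla_apply, proj, LinearMap.sum_apply]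
  refine Finset.sum_congr rfl fun i _ => ?_
  have : ∀ j, (if j ∈ insert i (∅ : Finset (Fin n)) then
      sgn j (insert i ∅) • K.del j (m ((insert i ∅ : Finset (Fin n)).erase j)) else 0) =
      if j = i then K.del i (m ∅) else 0 := by
    intro j
    by_cases h : j = i
    · subst h; simp [sgn, Finset.filter_singleton]
    · simp [h]
  simp only [this]
  simp [sgn]

theorem homotopy_koszul_add (m : Finset (Fin n) → V) :
    K.homotopy (K.koszul m) + K.koszul (K.homotopy m) =
      m - Pi.single ∅ (m ∅ - K.proj (m ∅)) := by
  ext A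
  by_cases hA : A = ∅
  · subst hA
    simp [homotopy_apply_empty, koszul_homotopy_apply_empty]
  · rw [← K.green_totalEuler_apply (_ + _) hA, map_add, homotopy, Module.End.mul_apply,
      K.totalEuler_green (K.nabla_apply_empty _), ← Module.End.mul_apply K.totalEuler,
      totalEuler_mul_koszul, Module.End.mul_apply, Module.End.mul_apply,
      K.totalEuler_green (K.nabla_apply_empty _), add_comm, ← Module.End.mul_apply,
      ← Module.End.mul_apply, ← LinearMap.add_apply, koszul_mul_nabla_add,
      K.green_totalEuler_apply _ hA]
    simp [hA]

theorem del_euler (i : Fin n) (v : V) :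
    K.del i (K.euler v) = K.euler (K.del i v) + K.del i v := by
  have : K.del i * K.euler = K.euler * K.del i + K.del i := by
    rw [euler, Finset.mul_sum, Finset.sum_mul]
    simp only [← mul_assoc, K.leibniz, add_mul, Finset.sum_add_distrib, ite_mul, one_mul,
      zero_mul]
    simp [mul_assoc, K.del_comm i]
  exact LinearMap.congr_fun this v

theorem proj_euler (v : V) : K.proj (K.euler v) = K.euler v := by
  simp only [proj, LinearMap.sum_apply, Module.End.mul_apply, del_euler]
  rw [euler, LinearMap.sum_apply]
  refine Finset.sum_congr rfl fun i _ => ?_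
  have := K.inv_apply one_pos (K.del i v)
  rw [one_smul] at this
  rw [← euler, this]; rfl

theorem proj_eq_zero {v : V} (hv : ∀ i, K.del i v = 0) : K.proj v = 0 := by
  simp [proj, hv]

theorem commute_inv {g : Module.End S V} (hu : ∀ i, Commute g (K.u i))
    (hdel : ∀ i, Commute g (K.del i)) {p : ℕ} (hp : 0 < p) : Commute g (K.inv p) := by
  have h : Commute g (p • 1 + ∑ i, K.u i * K.del i) :=
    ((Commute.one_right g).smul_right p).add_right
      (Commute.sum_right _ _ _ fun i _ => (hu i).mul_right (hdel i))
  calc g * K.inv p = K.inv p * (p • 1 + ∑ i, K.u i * K.del i) * g * K.inv p := by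
        rw [K.inv_mul p hp, one_mul]
    _ = K.inv p * g := by
        rw [mul_assoc (K.inv p), ← h.eq, mul_assoc, mul_assoc, K.mul_inv p hp, mul_one]

theorem commute_proj {g : Module.End S V} (hu : ∀ i, Commute g (K.u i))
    (hdel : ∀ i, Commute g (K.del i)) : Commute g K.proj :=
  Commute.sum_right _ _ _ fun i _ =>
    ((hu i).mul_right (K.commute_inv hu hdel one_pos)).mul_right (hdel i)

theorem commute_homotopy {g : Module.End S V} (hu : ∀ i, Commute g (K.u i))
    (hdel : ∀ i, Commute g (K.del i)) : Commute (coeff g) K.homotopy := by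
  refine Commute.mul_right ?_ (Commute.sum_right _ _ _ fun i _ =>
    Commute.mul_right ((hdel i).map coeff) (commute_coeff_create g i))
  refine LinearMap.ext fun m => funext fun A => ?_
  simp only [Module.End.mul_apply, green_apply, coeff_apply]
  split_ifs with h
  · simp
  · exact LinearMap.congr_fun (K.commute_inv hu hdel
      (Finset.card_pos.2 (Finset.nonempty_iff_ne_empty.2 h))).eq _

end Connection

/-- The basic perturbation lemma: `B` is the inverse of `1 + hD`, and `B * p` is homotopic to
the identity for the perturbed differential `D + k`. -/
theorem perturbation {A : Type*} [Ring A] {D k h p B : A} (hDk : D * k = -(k * D))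
    (hDDh : h * (D * D) * h = 0) (hk : h * k + k * h = 1 - p)
    (hp : p * D * h = 0) (hB : (1 + h * D) * B = 1) (hB' : B * (1 + h * D) = 1) :
    B * p = 1 - ((D + k) * (B * h) + B * h * (D + k)) := by
  have hsub : h * D * B = 1 - B := by
    rw [add_mul, one_mul] at hB; rw [← hB]; abel
  have hBh : B * h = h * (1 - D * B * h) := by
    rw [mul_sub, mul_one, ← mul_assoc, ← mul_assoc, hsub, sub_mul, one_mul]; abel
  have hinv : (1 + D * h) * (1 - D * B * h) = 1 := by
    have : (1 + D * h) * (1 - D * B * h) = 1 + D * h - D * ((1 + h * D) * B) * h := by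
      noncomm_ring
    rw [this, hB]; noncomm_ring
  have hkh : k * h = 1 - p - h * k := by rw [← hk]; abel
  have h1 : (1 + h * D) * (D + k) * h = k * h * (1 + D * h) := by
    have e1 : (1 + h * D) * (D + k) * h = D * h + k * h + h * (D * D) * h + h * (D * k) * h := by
      noncomm_ring
    have e2 : h * (D * k) * h = -((1 - p - k * h) * D * h) := by
      rw [hDk, ← hk]; noncomm_ring
    have e3 : (1 - p - k * h) * D * h = D * h - k * h * D * h := by
      have : (1 - p - k * h) * D * h = D * h - p * D * h - k * h * D * h := by noncomm_ring
      rw [this, hp, sub_zero]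
    rw [e1, e2, e3, hDDh]; noncomm_ring
  have h2 : (1 + h * D) * ((D + k) * (B * h)) = k * h := by
    rw [hBh, ← mul_assoc, ← mul_assoc, h1, mul_assoc, hinv, mul_one]
  have h3 : (1 + h * D) * (B * h * (D + k)) = h * D + h * k := by
    rw [← mul_assoc, ← mul_assoc, hB, one_mul, mul_add]
  calc B * p = B * ((1 + h * D) * (1 - ((D + k) * (B * h) + B * h * (D + k)))) := by
        rw [mul_sub, mul_add (1 + h * D), h2, h3, hkh, mul_one]
        congr 1; abel
    _ = _ := by rw [← mul_assoc, hB', one_mul]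

section Ring

variable {A : Type*} [Ring A]

theorem mul_mul_eq_neg {f g a p : A} (hfg : Commute f g) (hfa : Commute f a)
    (hgp : Commute g p) (hpa : p * a = -(a * p)) :
    f * p * (g * a) = -(g * a * (f * p)) := by
  rw [mul_assoc, ← mul_assoc p, ← hgp.eq, mul_assoc, hpa, mul_assoc g, ← mul_assoc a, ← hfa.eq]
  simp only [mul_neg, ← mul_assoc, hfg.eq]

theorem mul_mul_mul_eq_zero {x l a : A} (h : l * x = -(x * l)) (hx : x * a = 0) :
    x * (l * a) = 0 := by
  rw [← mul_assoc, ← neg_neg (x * l), ← h, neg_mul, mul_assoc, hx, mul_zero, neg_zero]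

theorem mul_mul_sub {D l a u : A} (hD : D * a = -(a * D)) (hl : D * l + l * D = u) :
    D * (l * a) - l * a * D = u * a := by
  rw [mul_assoc l, ← neg_neg (a * D), ← hD, ← hl]; noncomm_ring

theorem commute_mul_mul {g a b l : A} (h : l * (g * a) = -(g * a * l)) (hab : a * b = -(b * a))
    (hgb : Commute g b) : Commute (g * a) (l * b) := by
  rw [Commute, SemiconjBy, ← mul_assoc, ← neg_neg (g * a * l), ← h, neg_mul, mul_assoc l,
    mul_assoc g, hab, mul_neg, mul_neg, neg_neg, ← mul_assoc g, hgb.eq, mul_assoc, mul_assoc]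

theorem add_mul_one_sub {D x s y : A} (hD : D * y - y * D = x) (hs : Commute s y)
    (hx : x * y = 0) : (D + (x + s)) * (1 - y) = (1 - y) * (D + s) := by
  have : (D + (x + s)) * (1 - y) = (1 - y) * (D + s) + (x - (D * y - y * D)) - x * y -
      (s * y - y * s) := by noncomm_ring
  rw [this, hD, hx, hs.eq]; abel

theorem geom_sum_inverse {x : A} {k : ℕ} (hx : (-x) ^ k = 0) :
    (1 + x) * ∑ i ∈ Finset.range k, (-x) ^ i = 1 ∧
      (∑ i ∈ Finset.range k, (-x) ^ i) * (1 + x) = 1 := by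
  have h1 := mul_neg_geom_sum (-x) k
  have h2 := geom_sum_mul_neg (-x) k
  rw [hx, sub_neg_eq_add, sub_zero] at h1 h2
  exact ⟨h1, h2⟩

theorem mul_neg_mul_pow {g h D : A} (hh : Commute g h) (hD : g * D = -(D * g)) (k : ℕ) :
    g * (-(h * D)) ^ k = ((-1) ^ k : ℤ) • ((-(h * D)) ^ k * g) := by
  have h1 : SemiconjBy g (-(h * D)) (-(-(h * D))) := by
    rw [SemiconjBy, mul_neg, ← mul_assoc, hh.eq, mul_assoc, hD]; noncomm_ring
  rw [(h1.pow_right k).eq, neg_pow, mul_assoc]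
  simp

theorem add_mul_self_of_anticomm {D k : A} (hDk : D * k = -(k * D)) (hk : k * k = 0) :
    (D + k) * (D + k) = D * D := by
  rw [add_mul, mul_add, mul_add, hDk, hk]; abel

theorem commute_of_eq_one_sub {Δ Z H : A} (hZ : Z = 1 - (Δ * H + H * Δ))
    (hH : Commute (Δ * Δ) H) : Δ * Z = Z * Δ := by
  have : Δ * Z - Z * Δ = H * (Δ * Δ) - Δ * Δ * H := by rw [hZ]; noncomm_ring
  rw [hH.eq, sub_self] at this
  exact sub_eq_zero.1 this

end Ring

/-- The differential of `V ⊗ ⋀ Sⁿ` induced by `d`, anticommuting with the generators. -/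
def diff (d : Module.End S V) : Module.End S (Finset (Fin n) → V) := coeff d * parity

theorem diff_apply (d : Module.End S V) (m : Finset (Fin n) → V) (A : Finset (Fin n)) :
    diff d m A = ((-1) ^ A.card : ℤ) • d (m A) := by
  rw [diff, Module.End.mul_apply, coeff_apply, parity_apply, map_zsmul]

theorem diff_mul_annih {d u : Module.End S V} (hdu : Commute d u) (i : Fin n) :
    diff d * (coeff u * annih i) = -(coeff u * annih i * diff d) :=
  mul_mul_eq_neg (hdu.map coeff) (commute_coeff_annih d i) (commute_coeff_parity u)
    (parity_mul_annih i)

theorem diff_mul_koszul (K : Connection S V n) {d : Module.End S V}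
    (hdu : ∀ i, Commute d (K.u i)) : diff d * K.koszul = -(K.koszul * diff d) := by
  rw [Connection.koszul, Finset.mul_sum, Finset.sum_mul, ← Finset.sum_neg_distrib]
  exact Finset.sum_congr rfl fun i _ => diff_mul_annih (hdu i) i

/-- Multiplication by `1 - λₖ·annihₖ` removes the `k`-th Koszul differential. -/
theorem diff_add_sum_mul_prod {d : Module.End S V} {u lam : Fin n → Module.End S V}
    (hlu : ∀ i j, Commute (lam i) (u j)) (hlam : ∀ i, lam i * d + d * lam i = u i)
    (l : List (Fin n)) :
    (diff d + (l.map fun i => coeff (u i) * annih i).sum) *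
        (l.map fun k => 1 - diff (lam k) * annih k).prod =
      (l.map fun k => 1 - diff (lam k) * annih k).prod * diff d := by
  induction l with
  | nil => simp
  | cons k l ih =>
    rw [List.map_cons, List.map_cons, List.sum_cons, List.prod_cons, mul_assoc, ← ih,
      ← mul_assoc, ← mul_assoc]
    congr 1
    have h0 : coeff (u k) * annih k * (diff (lam k) * annih k) = 0 :=
      mul_mul_mul_eq_zero (diff_mul_annih (hlu k k) k)
        (by rw [mul_assoc, annih_mul_self, mul_zero])
    have h1 : diff d * (diff (lam k) * annih k) - diff (lam k) * annih k * diff d =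
        coeff (u k) * annih k := by
      refine mul_mul_sub ?_ ?_
      · have := diff_mul_annih (Commute.one_right d) k
        rwa [map_one, one_mul] at this
      · rw [diff, diff, parity_mul_coeff_mul_parity_mul_coeff,
          parity_mul_coeff_mul_parity_mul_coeff, ← map_add, add_comm, hlam]
    have h2 : ∀ l : List (Fin n), Commute (l.map fun i => coeff (u i) * annih i).sum
        (diff (lam k) * annih k) := fun l => by
      induction l with
      | nil => exact Commute.zero_left _
      | cons i l ih =>
        rw [List.map_cons, List.sum_cons]
        exact Commute.add_left (commute_mul_mul (diff_mul_annih (hlu k i) i)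
          (annih_mul_annih i k) (commute_coeff_annih (u i) k)) ih
    exact add_mul_one_sub h1 (h2 l) h0

namespace Connection

variable (K : Connection S V n)

theorem homotopy_diff_pow_apply_eq_zero (d : Module.End S V) (k : ℕ) (m : Finset (Fin n) → V)
    {A : Finset (Fin n)} (hA : A.card < k) : ((-(K.homotopy * diff d)) ^ k : Module.End S _) m A = 0 := by
  induction k generalizing A with
  | zero => simp at hA
  | succ k ih =>
    rw [pow_succ', Module.End.mul_apply, LinearMap.neg_apply, Pi.neg_apply, Module.End.mul_apply,
      K.homotopy_apply_eq_zero, neg_zero]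
    intro i hi
    rw [diff_apply, ih, map_zero, smul_zero]
    rw [← Finset.card_erase_add_one hi] at hA
    omega

theorem homotopy_diff_pow_single_apply (d : Module.End S V) (k : ℕ) (v : V)
    {A : Finset (Fin n)} (hA : A.card ≠ k) :
    ((-(K.homotopy * diff d)) ^ k : Module.End S _) (Pi.single ∅ v) A = 0 := by
  induction k generalizing A with
  | zero =>
    rw [pow_zero, Module.End.one_apply, Pi.single_eq_of_ne]
    rintro rfl; simp at hA
  | succ k ih =>
    rw [pow_succ', Module.End.mul_apply, LinearMap.neg_apply, Pi.neg_apply, Module.End.mul_apply,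
      K.homotopy_apply_eq_zero, neg_zero]
    intro i hi
    rw [diff_apply, ih, map_zero, smul_zero]
    rw [← Finset.card_erase_add_one hi] at hA
    omega

theorem nabla_homotopy_diff_pow_single (d : Module.End S V) (k : ℕ) {v : V}
    (hv : ∀ i, K.del i v = 0) :
    K.nabla (((-(K.homotopy * diff d)) ^ k : Module.End S _) (Pi.single ∅ v)) = 0 := by
  cases k with
  | zero =>
    ext A
    rw [pow_zero, Module.End.one_apply, nabla_apply]
    refine Finset.sum_eq_zero fun i _ => ?_
    split_ifs with h
    · by_cases hA : A.erase i = ∅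
      · rw [hA]; simp [hv]
      · rw [Pi.single_eq_of_ne hA]; simp
    · rfl
  | succ k =>
    rw [pow_succ', Module.End.mul_apply, LinearMap.neg_apply, map_neg, Module.End.mul_apply,
      homotopy, Module.End.mul_apply, nabla_green_nabla, neg_zero]

variable {mk : V →ₗ[S] V'} {C : Fin n → Module.End S V'}

theorem succ_smul_homotopy_diff_pow_single (hmk : ∀ i v, mk (K.u i v) = 0) {d : Module.End S V}
    (hC : ∀ i v, C i (mk v) = mk (K.del i (d v) - d (K.del i v))) (k : ℕ) {v : V}
    (hv : ∀ i, K.del i v = 0) :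
    (k + 1) • mk.compLeft _ (((-(K.homotopy * diff d)) ^ (k + 1) : Module.End S _) (Pi.single ∅ v)) =
      ((-1) ^ (k + 1) : ℤ) • (∑ i, create i * coeff (C i) : Module.End S _)
        (mk.compLeft _ (((-(K.homotopy * diff d)) ^ k : Module.End S _) (Pi.single ∅ v))) := by
  set w := ((-(K.homotopy * diff d)) ^ k : Module.End S _) (Pi.single ∅ v) with hw
  have hsupp : ∀ A : Finset (Fin n), A.card ≠ k → w A = 0 := fun A hA =>
    K.homotopy_diff_pow_single_apply d k v hA
  have hnw : K.nabla w = 0 := K.nabla_homotopy_diff_pow_single d k hv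
  have hpar : parity (S := S) w = ((-1) ^ k : ℤ) • w := by
    ext A
    rw [parity_apply, Pi.smul_apply]
    by_cases hA : A.card = k
    · rw [hA]
    · rw [hsupp A hA, smul_zero, smul_zero]
  have hy : K.nabla (diff d w) = ((-1) ^ k : ℤ) •
      (∑ i, create i * coeff (K.del i * d - d * K.del i) : Module.End S _) w := by
    have h1 : K.nabla * coeff d = (∑ i, create i * coeff (K.del i * d - d * K.del i)) +
        coeff d * K.nabla := by
      rw [nabla, Finset.sum_mul, Finset.mul_sum, ← Finset.sum_add_distrib]
      refine Finset.sum_congr rfl fun i _ => ?_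
      rw [mul_assoc, ← (commute_coeff_create d i).eq, ← mul_assoc, ← mul_assoc, ← map_mul,
        ← map_mul, (commute_coeff_create _ i).eq, (commute_coeff_create _ i).eq, ← mul_add,
        ← map_add, sub_add_cancel]
    rw [diff, Module.End.mul_apply, hpar, map_zsmul, map_zsmul, ← Module.End.mul_apply, h1,
      LinearMap.add_apply, Module.End.mul_apply, hnw, map_zero, add_zero]
  have hcomp : ∀ i, mk.compLeft _ (create (S := S) i (coeff (K.del i * d - d * K.del i) w)) =
      create (S := S) i (coeff (C i) (mk.compLeft _ w)) := fun i => by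
    rw [compLeft_create]
    congr 1
    ext A
    simp [coeff_apply, hC]
  have heuler : ∀ x, mk (K.euler x) = 0 := fun x => by
    simp [euler, LinearMap.sum_apply, hmk]
  have hgreen : (k + 1) • mk.compLeft _ (K.homotopy (diff d w)) =
      mk.compLeft _ (K.nabla (diff d w)) := by
    have hE := K.totalEuler_green (K.nabla_apply_empty (diff d w))
    ext A
    have hEA := congrArg mk (congrFun hE A)
    rw [totalEuler_apply, map_add, heuler, zero_add, map_nsmul] at hEA
    simp only [Pi.smul_apply, LinearMap.compLeft_apply, Function.comp_apply]
    rw [← hEA, homotopy, Module.End.mul_apply]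
    by_cases hA : A.card = k + 1
    · rw [hA]
    · have : K.homotopy (diff d w) A = 0 := by
        refine K.homotopy_apply_eq_zero fun i hi => ?_
        rw [diff_apply, hsupp, map_zero, smul_zero]
        rw [← Finset.card_erase_add_one hi] at hA
        omega
      rw [homotopy, Module.End.mul_apply] at this
      rw [this]; simp
  rw [pow_succ', Module.End.mul_apply, ← hw, LinearMap.neg_apply, map_neg, smul_neg,
    Module.End.mul_apply, hgreen, hy, map_zsmul, pow_succ, mul_neg_one, neg_smul,
    LinearMap.sum_apply, map_sum, LinearMap.sum_apply]
  simp only [Module.End.mul_apply, hcomp]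

theorem factorial_smul_homotopy_diff_pow_single (hmk : ∀ i v, mk (K.u i v) = 0)
    {d : Module.End S V} (hC : ∀ i v, C i (mk v) = mk (K.del i (d v) - d (K.del i v))) (k : ℕ)
    {v : V} (hv : ∀ i, K.del i v = 0) :
    k.factorial • mk.compLeft _ (((-(K.homotopy * diff d)) ^ k : Module.End S _) (Pi.single ∅ v)) =
      ((-1) ^ k * (-1) ^ (k * (k - 1) / 2) : ℤ) •
        ((∑ i, create i * coeff (C i) : Module.End S _) ^ k) (Pi.single ∅ (mk v)) := by
  induction k with
  | zero =>
    simp only [Nat.factorial_zero, one_smul, pow_zero, Module.End.one_apply, Nat.zero_mul,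
      Nat.zero_div, mul_one]
    ext A
    by_cases hA : A = ∅
    · subst hA; simp
    · simp [hA]
  | succ k ih =>
    rw [Nat.factorial_succ, mul_comm, mul_smul, K.succ_smul_homotopy_diff_pow_single hmk hC k hv,
      smul_comm, ← map_nsmul, ih, map_zsmul, smul_smul, pow_succ' (∑ i, _), Module.End.mul_apply]
    congr 1
    have : (k + 1) * (k + 1 - 1) / 2 = k * (k - 1) / 2 + k := by
      rw [← Finset.sum_range_id_mul_two, ← Finset.sum_range_id_mul_two,
        Nat.mul_div_cancel _ two_pos, Nat.mul_div_cancel _ two_pos, Finset.sum_range_succ]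
    rw [this]; ring

end Connection

theorem prod_ofFn_mul {A : Type*} [Monoid A] {k : ℕ} (a b : Fin k → A)
    (h : ∀ i j, Commute (b i) (a j)) :
    (List.ofFn fun i => a i * b i).prod = (List.ofFn a).prod * (List.ofFn b).prod := by
  induction k with
  | zero => simp
  | succ k ih =>
    rw [List.ofFn_succ, List.ofFn_succ, List.ofFn_succ, List.prod_cons, List.prod_cons,
      List.prod_cons, ih _ _ fun i j => h i.succ j.succ, mul_assoc, mul_assoc,
      ← mul_assoc (b 0), ← mul_assoc _ (b 0)]
    congr 2
    refine Commute.list_prod_right _ _ fun x hx => ?_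
    obtain ⟨i, rfl⟩ := (List.mem_ofFn' _ _).1 hx
    exact h 0 i.succ

theorem sum_create_mul_coeff_pow_single (C : Fin n → Module.End S V) (v : V) :
    ((∑ i, create i * coeff (C i) : Module.End S _) ^ n) (Pi.single ∅ v) Finset.univ =
      ∑ τ : Equiv.Perm (Fin n), (Equiv.Perm.sign τ : ℤ) •
        (List.ofFn fun k => C (τ k)).prod v := by
  have h1 : (∑ i, create i * coeff (C i) : Module.End S (Finset (Fin n) → V)) ^ n =
      ∑ r : Fin n → Fin n, createAlternating S n V (fun j => Pi.single (r j) 1) *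
        coeff (List.ofFn fun k => C (r k)).prod := by
    rw [← MultilinearMap.mkPiAlgebraFin_apply_const (R := S), MultilinearMap.map_sum]
    refine Finset.sum_congr rfl fun r _ => ?_
    rw [MultilinearMap.mkPiAlgebraFin_apply, createAlternating_apply,
      prod_ofFn_mul (fun k => create (r k)) (fun k => coeff (C (r k)))
        fun _ _ => commute_coeff_create _ _, map_list_prod, List.map_ofFn]
    rfl
  have h2 : (∑ i, create i * coeff (C i) : Module.End S (Finset (Fin n) → V)) ^ n =
      ∑ τ : Equiv.Perm (Fin n), (Equiv.Perm.sign τ : ℤ) • ((List.ofFn create).prod *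
        coeff (List.ofFn fun k => C (τ k)).prod) := by
    rw [h1]
    symm
    refine Fintype.sum_of_injective (fun τ : Equiv.Perm (Fin n) => (τ : Fin n → Fin n))
      DFunLike.coe_injective _ _ (fun r hr => ?_) fun τ => ?_
    · rw [AlternatingMap.map_eq_zero_of_not_injective, zero_mul]
      intro hinj
      refine hr ⟨Equiv.ofBijective r (Finite.injective_iff_bijective.1 fun i j hij => ?_), rfl⟩
      exact hinj (by simp only [hij])
    · have := (createAlternating S n V).map_perm (fun j => Pi.single j 1) τ
      rw [← smul_mul_assoc]
      congr 1
      refine Eq.trans ?_ this.symm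
      rw [← createAlternating_apply]; rfl
  rw [h2, LinearMap.sum_apply, Finset.sum_apply]
  refine Finset.sum_congr rfl fun τ _ => ?_
  rw [LinearMap.smul_apply, Pi.smul_apply, Module.End.mul_apply]
  congr 1
  have hs : coeff (List.ofFn fun k => C (τ k)).prod (Pi.single (∅ : Finset (Fin n)) v) =
      Pi.single ∅ ((List.ofFn fun k => C (τ k)).prod v) := by
    ext A
    rw [coeff_apply]
    by_cases hA : A = ∅
    · subst hA; simp
    · simp [hA]
  rw [hs, List.ofFn_eq_map, ← List.toFinset_finRange]
  exact prod_create_single_apply _ (List.pairwise_lt_finRange n) _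

theorem coeff_single_empty (f : Module.End S V) (v : V) :
    coeff f (Pi.single (∅ : Finset (Fin n)) v) = Pi.single ∅ (f v) := by
  ext A
  rw [coeff_apply]
  by_cases hA : A = ∅
  · subst hA; simp
  · simp [hA]

theorem diff_single_univ (d : Module.End S V) (v : V) :
    diff d (Pi.single (Finset.univ : Finset (Fin n)) v) =
      Pi.single Finset.univ (((-1) ^ n : ℤ) • d v) := by
  ext A
  rw [diff_apply]
  by_cases hA : A = Finset.univ
  · subst hA; simp
  · simp [hA]

namespace Connection

variable (K : Connection S V n) {mk : V →ₗ[S] V'}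

theorem koszul_apply_univ (m : Finset (Fin n) → V) : K.koszul m Finset.univ = 0 := by
  simp [koszul_apply]

theorem koszul_single_empty_apply (v : V) :
    K.koszul (Pi.single ∅ v) ∅ = 0 := by
  simp [koszul_apply]

/-- The section of `mk` along the flat sections. -/
theorem exists_section (hsurj : Function.Surjective mk)
    (hker : ∀ v, mk v = 0 → ∃ s, K.euler s = v) :
    ∃ σ : V' →ₗ[S] V, ∀ v, σ (mk v) = v - K.proj v := by
  have h : LinearMap.ker mk ≤ LinearMap.ker (LinearMap.id - K.proj) := fun v hv => by
    obtain ⟨s, rfl⟩ := hker v hv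
    simp [proj_euler]
  refine ⟨(LinearMap.ker mk).liftQ _ h ∘ₗ
    (mk.quotKerEquivOfSurjective hsurj).symm.toLinearMap, fun v => ?_⟩
  have : (mk.quotKerEquivOfSurjective hsurj).symm (mk v) = Submodule.Quotient.mk v := by
    rw [LinearEquiv.symm_apply_eq]; rfl
  simp [this]

/-- The projection of the Koszul complex onto its flat sections in degree zero. -/
def flatProj : Module.End S (Finset (Fin n) → V) :=
  LinearMap.single S _ ∅ ∘ₗ (LinearMap.id - K.proj) ∘ₗ LinearMap.proj ∅

theorem flatProj_apply (m : Finset (Fin n) → V) :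
    K.flatProj m = Pi.single ∅ (m ∅ - K.proj (m ∅)) := rfl

/-- The inverse of `1 + hD` for the homotopy `h` and the differential `D`. -/
def resolvent (d : Module.End S V) : Module.End S (Finset (Fin n) → V) :=
  ∑ i ∈ Finset.range (n + 1), (-(K.homotopy * diff d)) ^ i

theorem resolvent_mul_flatProj {d : Module.End S V} {W : S} (hd : d * d = W • 1)
    (hdu : ∀ i, Commute d (K.u i)) :
    K.resolvent d * K.flatProj = 1 - ((diff d + K.koszul) * (K.resolvent d * K.homotopy) +
      K.resolvent d * K.homotopy * (diff d + K.koszul)) := by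
  have hnil : (-(K.homotopy * diff d)) ^ (n + 1) = 0 := by
    refine LinearMap.ext fun m => funext fun A => K.homotopy_diff_pow_apply_eq_zero d _ m ?_
    exact Nat.lt_succ_of_le (by simpa using Finset.card_le_univ A)
  obtain ⟨h1, h2⟩ := geom_sum_inverse hnil
  refine perturbation (diff_mul_koszul K hdu) ?_ ?_ ?_ h1 h2
  · rw [diff, parity_mul_coeff_mul_parity_mul_coeff, hd]
    refine LinearMap.ext fun m => ?_
    have : coeff (W • 1 : Module.End S V) (K.homotopy m) = W • K.homotopy m := rfl
    rw [Module.End.mul_apply, Module.End.mul_apply, this, map_smul, ← Module.End.mul_apply,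
      homotopy_mul_self]
    simp
  · refine LinearMap.ext fun m => ?_
    rw [LinearMap.add_apply, Module.End.mul_apply, Module.End.mul_apply, homotopy_koszul_add]
    rfl
  · refine LinearMap.ext fun m => ?_
    rw [Module.End.mul_apply, Module.End.mul_apply, flatProj_apply, diff_apply,
      homotopy_apply_empty]
    simp

/-- The inclusion of the top exterior degree, corrected by the homotopies `lam`. -/
def topInclusion (lam : Fin n → Module.End S V) : V →ₗ[S] (Finset (Fin n) → V) :=
  ((List.finRange n).map fun k => 1 - diff (lam k) * annih k : List (Module.End S _)).prod ∘ₗ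
    LinearMap.single S (fun _ => V) Finset.univ

theorem topInclusion_apply_empty (lam : Fin n → Module.End S V) (v : V) :
    topInclusion lam v ∅ = ((-1) ^ n : ℤ) • (List.ofFn lam).prod v := by
  have := prod_one_sub_single_apply lam (List.finRange n) (List.pairwise_lt_finRange n) ∅
    (by simp) v
  rw [List.toFinset_finRange, Finset.empty_union, List.length_finRange] at this
  rw [List.ofFn_eq_map]
  exact this

theorem topInclusion_apply_univ (lam : Fin n → Module.End S V) (v : V) :
    topInclusion lam v Finset.univ = v := by
  have : ∀ l : List (Fin n), (l.map fun k => 1 - diff (lam k) * annih k :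
      List (Module.End S _)).prod (Pi.single Finset.univ v) Finset.univ = v := fun l => by
    induction l with
    | nil => simp
    | cons k l ih =>
      rw [List.map_cons, List.prod_cons, Module.End.mul_apply, LinearMap.sub_apply, Pi.sub_apply,
        Module.End.one_apply, ih, Module.End.mul_apply, diff_apply, annih_apply]
      simp
  exact this _

theorem diff_add_koszul_topInclusion {d : Module.End S V} {lam : Fin n → Module.End S V}
    (hlu : ∀ i j, Commute (lam i) (K.u j)) (hlam : ∀ i, lam i * d + d * lam i = K.u i) (v : V) :
    (diff d + K.koszul : Module.End S _) (topInclusion lam v) =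
      topInclusion lam (((-1) ^ n : ℤ) • d v) := by
  have h := LinearMap.congr_fun (diff_add_sum_mul_prod hlu hlam (List.finRange n))
    (Pi.single Finset.univ v)
  rw [← List.ofFn_eq_map, List.sum_ofFn, Module.End.mul_apply, Module.End.mul_apply,
    diff_single_univ] at h
  exact h

/-- The pushforward theorem with its explicit idempotent: for `mk : V → V'` the quotient by the
image of the operators `u i`, the map `ψ` is a chain map which is left inverse, up to homotopy,
to the composite of `mk` with the product of the homotopies `lam`. -/
theorem exists_pushforward (hsurj : Function.Surjective mk) (hmk : ∀ i v, mk (K.u i v) = 0)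
    (hker : ∀ v, mk v = 0 → ∃ s, K.euler s = v)
    (hdec : ∀ v, ∃ k, (∀ i, K.del i k = 0) ∧ ∃ s, v = k + K.euler s)
    {d : Module.End S V} {W : S} (hd : d * d = W • 1) (hdu : ∀ i, Commute d (K.u i))
    {lam : Fin n → Module.End S V} (hlu : ∀ i j, Commute (lam i) (K.u j))
    (hlam : ∀ i, lam i * d + d * lam i = K.u i) {C : Fin n → Module.End S V'}
    (hC : ∀ i v, C i (mk v) = mk (K.del i (d v) - d (K.del i v))) :
    ∃ (ψ : V' →ₗ[S] V) (H : V →ₗ[S] V),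
      (∀ (g : Module.End S V) (g' : Module.End S V'), (∀ i, Commute g (K.u i)) →
        (∀ i, Commute g (K.del i)) → g * d = -(d * g) → (∀ v, g' (mk v) = mk (g v)) →
        ∀ x, ((-1) ^ n : ℤ) • g (ψ x) = ψ (g' x)) ∧
      (∀ d' : Module.End S V', (∀ v, d' (mk v) = mk (d v)) →
        ∀ x, ((-1) ^ n : ℤ) • d (ψ x) = ψ (d' x)) ∧
      (∀ v, ψ (((-1) ^ n : ℤ) • mk ((List.ofFn lam).prod v)) - v =
        ((-1) ^ n : ℤ) • d (H v) + H (((-1) ^ n : ℤ) • d v)) ∧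
      ∀ x, n.factorial • mk (ψ x) = ((-1) ^ n * (-1) ^ (n * (n - 1) / 2) : ℤ) •
        ∑ τ : Equiv.Perm (Fin n), (Equiv.Perm.sign τ : ℤ) •
          (List.ofFn fun k => C (τ k)).prod x := by
  obtain ⟨σ, hσ⟩ := K.exists_section hsurj hker
  have hσ_flat : ∀ x i, K.del i (σ x) = 0 := fun x i => by
    obtain ⟨v, rfl⟩ := hsurj x
    obtain ⟨k, hk, s, rfl⟩ := hdec v
    simp [hσ, K.proj_euler, K.proj_eq_zero hk, hk]
  have hmk_proj : ∀ v, mk (K.proj v) = 0 := fun v => by simp [proj, hmk]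
  have hmkσ : ∀ x, mk (σ x) = x := fun x => by
    obtain ⟨v, rfl⟩ := hsurj x
    rw [hσ, map_sub, hmk_proj, sub_zero]
  let ψ : V' →ₗ[S] V :=
    LinearMap.proj Finset.univ ∘ₗ K.resolvent d ∘ₗ LinearMap.single S _ ∅ ∘ₗ σ
  have hψ : ∀ x, ψ x = ((-(K.homotopy * diff d)) ^ n : Module.End S _)
      (Pi.single ∅ (σ x)) Finset.univ := fun x => by
    change K.resolvent d (Pi.single ∅ (σ x)) Finset.univ = _
    rw [resolvent, LinearMap.sum_apply, Finset.sum_apply,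
      Finset.sum_eq_single_of_mem n (Finset.self_mem_range_succ n)]
    intro k _ hk
    exact K.homotopy_diff_pow_single_apply d k _ (by simpa using hk.symm)
  have hψ_mk : ∀ m : Finset (Fin n) → V,
      ψ (mk (m ∅)) = (K.resolvent d * K.flatProj) m Finset.univ := fun m => by
    change K.resolvent d (Pi.single ∅ (σ (mk (m ∅)))) Finset.univ = _
    rw [hσ, Module.End.mul_apply, flatProj_apply]
  have hZ := K.resolvent_mul_flatProj hd hdu
  have htop : ∀ m : Finset (Fin n) → V,
      (diff d + K.koszul : Module.End S _) m Finset.univ =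
        ((-1) ^ n : ℤ) • d (m Finset.univ) := fun m => by
    rw [LinearMap.add_apply, Pi.add_apply, koszul_apply_univ, diff_apply, add_zero]; simp
  have hZΔ : (diff d + K.koszul) * (K.resolvent d * K.flatProj) =
      K.resolvent d * K.flatProj * (diff d + K.koszul) := by
    refine commute_of_eq_one_sub hZ ?_
    rw [add_mul_self_of_anticomm (diff_mul_koszul K hdu) K.koszul_mul_self, diff,
      parity_mul_coeff_mul_parity_mul_coeff, hd]
    refine LinearMap.ext fun m => ?_
    exact (map_smul (K.resolvent d * K.homotopy) W m).symm
  refine ⟨ψ, -(LinearMap.proj Finset.univ ∘ₗ (K.resolvent d * K.homotopy) ∘ₗ topInclusion lam),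
    ?_, ?_, ?_, ?_⟩
  · intro g g' hgu hgdel hgd hg' x
    have hgσ : g (σ x) = σ (g' x) := by
      obtain ⟨v, rfl⟩ := hsurj x
      rw [hσ, hg', hσ, map_sub]
      congr 1
      exact LinearMap.congr_fun (K.commute_proj hgu hgdel).eq v
    have hgD : coeff g * diff d = -(diff d * coeff g : Module.End S (Finset (Fin n) → V)) := by
      rw [diff, ← mul_assoc, ← map_mul, hgd, mul_assoc, ← (commute_coeff_parity g).eq,
        ← mul_assoc, ← map_mul]
      refine LinearMap.ext fun m => funext fun A => ?_
      rfl
    have := LinearMap.congr_fun (mul_neg_mul_pow (K.commute_homotopy hgu hgdel) hgD n)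
      (Pi.single ∅ (σ x))
    have := congrFun this Finset.univ
    rw [Module.End.mul_apply, LinearMap.smul_apply, Pi.smul_apply, Module.End.mul_apply,
      coeff_single_empty, hgσ, ← hψ, coeff_apply, ← hψ] at this
    rw [this, smul_smul, ← mul_pow]
    simp
  · intro d' hd' x
    obtain ⟨v, rfl⟩ := hsurj x
    have h := congrFun (LinearMap.congr_fun hZΔ (Pi.single ∅ v)) Finset.univ
    rw [Module.End.mul_apply _ (K.resolvent d * K.flatProj), htop, ← hψ_mk, Pi.single_eq_same,
      Module.End.mul_apply _ (diff d + K.koszul), ← hψ_mk, LinearMap.add_apply, Pi.add_apply,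
      koszul_single_empty_apply, diff_apply, Pi.single_eq_same, add_zero] at h
    rw [h, hd']
    simp
  · intro v
    rw [← map_zsmul, ← topInclusion_apply_empty, hψ_mk, hZ, LinearMap.sub_apply,
      LinearMap.add_apply, Pi.sub_apply, Pi.add_apply, Module.End.mul_apply (diff d + K.koszul),
      htop, Module.End.mul_apply _ (diff d + K.koszul), diff_add_koszul_topInclusion K hlu hlam,
      Module.End.one_apply, topInclusion_apply_univ]
    simp only [LinearMap.neg_apply, LinearMap.comp_apply, LinearMap.proj_apply, map_neg, smul_neg]
    abel
  · intro x
    have h := congrFun (K.factorial_smul_homotopy_diff_pow_single hmk hC n (hσ_flat x))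
      Finset.univ
    rw [Pi.smul_apply, Pi.smul_apply, LinearMap.compLeft_apply, Function.comp_apply, ← hψ, hmkσ,
      sum_create_mul_coeff_pow_single] at h
    exact h

end Connection

end Koszul

namespace Stmt12

section Reduction

variable (S : Type*) {R : Type*} [CommRing S] [CommRing R] [Algebra S R]

/-- The quotient map `X → X/IX` on free modules. -/
def reduce (I : Ideal R) (ι : Type*) : (ι → R) →ₗ[S] (ι → R ⧸ I) :=
  (I.mkQ.restrictScalars S).compLeft ι

variable {S} {I : Ideal R} {ι : Type*}

theorem reduce_apply (v : ι → R) (a : ι) : reduce S I ι v a = Ideal.Quotient.mk I (v a) := rfl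

theorem reduce_surjective : Function.Surjective (reduce S I ι) := fun x =>
  ⟨fun a => (Ideal.Quotient.mk_surjective (x a)).choose,
    funext fun a => (Ideal.Quotient.mk_surjective (x a)).choose_spec⟩

theorem reduce_eq_zero_iff (v : ι → R) : reduce S I ι v = 0 ↔ ∀ a, v a ∈ I := by
  simp only [funext_iff, reduce_apply, Pi.zero_apply, Ideal.Quotient.eq_zero_iff_mem]

theorem reduce_smul_of_mem {r : R} (hr : r ∈ I) (v : ι → R) : reduce S I ι (r • v) = 0 :=
  (reduce_eq_zero_iff _).2 fun a => I.mul_mem_right (v a) hr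

theorem prod_map_restrictScalars_apply (l : List (Module.End R (ι → R))) (v : ι → R) :
    (l.map fun f => (f.restrictScalars S : Module.End S (ι → R))).prod v = l.prod v := by
  induction l with
  | nil => rfl
  | cons f l ih =>
    rw [List.map_cons, List.prod_cons, Module.End.mul_apply, ih, List.prod_cons,
      Module.End.mul_apply, LinearMap.restrictScalars_apply]

variable [Fintype ι] [DecidableEq ι]

theorem apply_eq_sum_dmat (f : Module.End R (ι → R)) (v : ι → R) (a : ι) :
    f v a = ∑ b, dmat f a b * v b := by
  conv_lhs => rw [pi_eq_sum_univ' v]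
  rw [map_sum, Finset.sum_apply]
  refine Finset.sum_congr rfl fun b _ => ?_
  rw [map_smul, Pi.smul_apply, smul_eq_mul, mul_comm, dmat]

theorem matExt_dmat_reduce (f : Module.End R (ι → R)) (v : ι → R) :
    (matExt (dmat f) : Module.End R (ι → R ⧸ I)) (reduce S I ι v) = reduce S I ι (f v) := by
  funext a
  rw [reduce_apply, apply_eq_sum_dmat, map_sum, matExt, LinearMap.pi_apply, LinearMap.sum_apply]
  exact Finset.sum_congr rfl fun b _ => rfl

theorem prod_matExt_dmat_reduce (l : List (Module.End R (ι → R))) (v : ι → R) :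
    (l.map fun f => (matExt (dmat f) : Module.End R (ι → R ⧸ I))).prod (reduce S I ι v) =
      reduce S I ι (l.prod v) := by
  induction l with
  | nil => rfl
  | cons f l ih =>
    rw [List.map_cons, List.prod_cons, Module.End.mul_apply, ih, matExt_dmat_reduce,
      List.prod_cons, Module.End.mul_apply]

/-- An operator anticommuting modulo `I` with each factor of a product anticommutes with the
product modulo `I`, up to the sign given by the number of factors. -/
theorem reduce_apply_prod (d : Module.End R (ι → R)) (l : List (Module.End R (ι → R)))
    (h : ∀ f ∈ l, ∃ r ∈ I, f * d + d * f = r • (1 : Module.End R (ι → R))) (v : ι → R) :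
    reduce S I ι (d (l.prod v)) = ((-1) ^ l.length : ℤ) • reduce S I ι (l.prod (d v)) := by
  induction l with
  | nil => simp
  | cons f l ih =>
    obtain ⟨r, hr, hf⟩ := h f (by simp)
    have hf' : d (f (l.prod v)) = r • l.prod v - f (d (l.prod v)) := by
      rw [eq_sub_iff_add_eq, add_comm]
      exact LinearMap.congr_fun hf (l.prod v)
    rw [List.prod_cons, Module.End.mul_apply, hf', map_sub, reduce_smul_of_mem hr, zero_sub,
      ← matExt_dmat_reduce, ih fun g hg => h g (by simp [hg]), map_zsmul, matExt_dmat_reduce,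
      Module.End.mul_apply, List.length_cons, pow_succ, mul_neg_one, neg_smul]

end Reduction

section Connection

variable {S R : Type*} [CommRing S] [CommRing R] [Algebra S R] {n : ℕ}

theorem sum_mulLeft_mul_compLeft (ι : Type*) (u : Fin n → R) (dd : Fin n → (R →ₗ[S] R)) :
    ∑ i, (LinearMap.mulLeft S (u i)).compLeft ι * (dd i).compLeft ι =
      (delNabla0 u dd).compLeft ι := by
  refine LinearMap.ext fun v => funext fun a => ?_
  simp [delNabla0]

/-- The extension of a standard flat connection on `R` over the basis of `ι → R`. -/
noncomputable def connection (ι : Type*) (u : Fin n → R) (dd : Fin n → (R →ₗ[S] R))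
    (hleib : ∀ i j r, dd j (u i * r) = u i * dd j r + (if i = j then r else 0))
    (hflat : ∀ i j, dd i ∘ₗ dd j = dd j ∘ₗ dd i)
    (hbij : ∀ p : ℕ, 0 < p →
      Function.Bijective (p • (LinearMap.id : R →ₗ[S] R) + delNabla0 u dd)) :
    Koszul.Connection S (ι → R) n where
  u i := (LinearMap.mulLeft S (u i)).compLeft ι
  del j := (dd j).compLeft ι
  u_comm i j := LinearMap.ext fun v => funext fun a => mul_left_comm (u i) (u j) (v a)
  del_comm i j := LinearMap.ext fun v => funext fun a => LinearMap.congr_fun (hflat i j) (v a)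
  leibniz i j := by
    refine LinearMap.ext fun v => funext fun a => (hleib i j (v a)).trans ?_
    split_ifs <;> rfl
  inv p := if hp : 0 < p then
    ((LinearEquiv.ofBijective _ (hbij p hp)).symm : R →ₗ[S] R).compLeft ι else 0
  inv_mul p hp := by
    rw [dif_pos hp, sum_mulLeft_mul_compLeft]
    exact LinearMap.ext fun v => funext fun a =>
      (LinearEquiv.ofBijective _ (hbij p hp)).symm_apply_apply (v a)
  mul_inv p hp := by
    rw [dif_pos hp, sum_mulLeft_mul_compLeft]
    exact LinearMap.ext fun v => funext fun a =>
      (LinearEquiv.ofBijective _ (hbij p hp)).apply_symm_apply (v a)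

theorem connection_euler_apply (ι : Type*) (u : Fin n → R) (dd : Fin n → (R →ₗ[S] R))
    (hleib : ∀ i j r, dd j (u i * r) = u i * dd j r + (if i = j then r else 0))
    (hflat : ∀ i j, dd i ∘ₗ dd j = dd j ∘ₗ dd i)
    (hbij : ∀ p : ℕ, 0 < p →
      Function.Bijective (p • (LinearMap.id : R →ₗ[S] R) + delNabla0 u dd)) (v : ι → R) (a : ι) :
    (connection ι u dd hleib hflat hbij).euler v a = delNabla0 u dd (v a) :=
  congrFun (LinearMap.congr_fun (sum_mulLeft_mul_compLeft ι u dd) v) a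

end Connection

end Stmt12

open Stmt12 in
theorem statement12
    {S R : Type*} [CommRing S] [CommRing R] [Algebra ℚ S] [Algebra S R] (W : S) {n : ℕ}
    -- X a finite rank matrix factorisation of φ(W) over R with homogeneous basis
    {ι : Type*} [Fintype ι] [DecidableEq ι] (par : ι → Bool)
    (d : Module.End R (ι → R))
    (hd_odd : d * gX R par = -(gX R par * d))
    (hd_sq : d * d = algebraMap S R W • (1 : Module.End R (ι → R)))
    -- a quasi-regular sequence with R/tR finitely generated projective over S
    (u : Fin n → R) (hqreg : IsQuasiRegular u)
    (hfin : Module.Finite S (R ⧸ Ideal.span (Set.range u)))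
    (hproj : Module.Projective S (R ⧸ Ideal.span (Set.range u)))
    -- odd homotopies λⱼ with λⱼd + dλⱼ = tⱼ·1
    (lam : Fin n → Module.End R (ι → R))
    (hlam_odd : ∀ j, lam j * gX R par = -(gX R par * lam j))
    (hlam : ∀ j, lam j * d + d * lam j = u j • (1 : Module.End R (ι → R)))
    -- a standard flat S-linear connection on R over S[t], with Ker(∇⁰) + tR = R
    (dd : Fin n → (R →ₗ[S] R))
    (hleib : ∀ i j r, dd j (u i * r) = u i * dd j r + (if i = j then r else 0))
    (hflat : ∀ i j, dd i ∘ₗ dd j = dd j ∘ₗ dd i)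
    (hstd_bij : ∀ p : ℕ, 0 < p →
      Function.Bijective (p • (LinearMap.id : R →ₗ[S] R) + delNabla0 u dd))
    (hstd_ideal : ∀ p : ℕ, 0 < p →
      Submodule.map (p • (LinearMap.id : R →ₗ[S] R) + delNabla0 u dd)
        ((Ideal.span (Set.range u)).restrictScalars S) =
        (Ideal.span (Set.range u)).restrictScalars S)
    (hstd_im : LinearMap.range (delNabla0 u dd) =
      (Ideal.span (Set.range u)).restrictScalars S)
    (hker : (⨅ j, LinearMap.ker (dd j)) ⊔
      (Ideal.span (Set.range u)).restrictScalars S = ⊤)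
    -- the descended commutators [∂ⱼ, a] on R/tR
    (C : Fin n → R → Module.End S (R ⧸ Ideal.span (Set.range u)))
    (hC : ∀ (j : Fin n) (a x : R),
      C j a (Ideal.Quotient.mk (Ideal.span (Set.range u)) x) =
        Ideal.Quotient.mk (Ideal.span (Set.range u)) (dd j (a * x) - a * dd j x)) :
    -- data of the statement
    let Q := R ⧸ Ideal.span (Set.range u)
    let DQ : Module.End R (ι → Q) := matExt (dmat d)            -- differential of X/tX
    let GQ : Module.End R (ι → Q) :=
      matExt (dmat (gX R par))                                  -- grading of X/tX
    let Dn : Module.End R (ι → R) := ((-1 : R) ^ n) • d         -- differential of X[n]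
    let Gn : Module.End R (ι → R) := ((-1 : R) ^ n) • gX R par  -- grading of X[n]
    -- e = (1/n!)(-1)^{n(n-1)/2} Σ_{τ∈Sₙ} sgn(τ) λ₁⋯λₙ [∂_{τ(1)},d_X]⋯[∂_{τ(n)},d_X],
    -- as an S-linear endomorphism of X/tX
    let e : Module.End S (ι → Q) :=
      algebraMap ℚ S (((-1 : ℚ) ^ (n * (n - 1) / 2)) / (n.factorial : ℚ)) •
        ∑ τ : Equiv.Perm (Fin n),
          (Equiv.Perm.sign τ : ℤ) •
            (((List.ofFn fun j =>
                (matExt (dmat (lam j)) : Module.End R (ι → Q))).prod).restrictScalars S *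
              ((List.ofFn fun kk =>
                (LinearMap.pi fun a => ∑ b, C (τ kk) (dmat d a b) ∘ₗ LinearMap.proj b :
                  Module.End S (ι → Q))).prod))
    -- the statement: the idempotent corresponding to the summand φ_*(X)[n] of X/tX,
    -- i.e. θψ for morphisms ψ, θ in the homotopy category with ψθ = 1, is given by e.
    ∃ (ψ : (ι → Q) →ₗ[S] (ι → R)) (θ : (ι → R) →ₗ[S] (ι → Q)),
      (Gn.restrictScalars S ∘ₗ ψ = ψ ∘ₗ GQ.restrictScalars S) ∧
      (Dn.restrictScalars S ∘ₗ ψ = ψ ∘ₗ DQ.restrictScalars S) ∧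
      (GQ.restrictScalars S ∘ₗ θ = θ ∘ₗ Gn.restrictScalars S) ∧
      (DQ.restrictScalars S ∘ₗ θ = θ ∘ₗ Dn.restrictScalars S) ∧
      (∃ Hm : (ι → R) →ₗ[S] (ι → R),
        ψ ∘ₗ θ - LinearMap.id =
          Dn.restrictScalars S ∘ₗ Hm + Hm ∘ₗ Dn.restrictScalars S) ∧
      (∃ Hm' : (ι → Q) →ₗ[S] (ι → Q),
        θ ∘ₗ ψ - e =
          DQ.restrictScalars S ∘ₗ Hm' + Hm' ∘ₗ DQ.restrictScalars S) := by
  intro Q DQ GQ Dn Gn e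
  let K := connection ι u dd hleib hflat hstd_bij
  have hmem : ∀ i, u i ∈ Ideal.span (Set.range u) := fun i => Ideal.subset_span ⟨i, rfl⟩
  have hKu : ∀ i v, K.u i v = u i • v := fun i v => rfl
  have hcomm : ∀ (f : Module.End R (ι → R)) i, Commute (f.restrictScalars S) (K.u i) := fun f i =>
    LinearMap.ext fun v => map_smul f (u i) v
  obtain ⟨ψ, H, hgr, hch, hψθ, hθψ⟩ := K.exists_pushforward
    (mk := reduce S (Ideal.span (Set.range u)) ι) reduce_surjective
    (fun i v => reduce_smul_of_mem (hmem i) v)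
    (fun v hv => by
      have : ∀ a, ∃ s, delNabla0 u dd s = v a := fun a => by
        rw [← LinearMap.mem_range, hstd_im]
        exact (reduce_eq_zero_iff v).1 hv a
      choose s hs using this
      exact ⟨s, funext fun a => (connection_euler_apply ι u dd hleib hflat hstd_bij s a).trans
        (hs a)⟩)
    (fun v => by
      have : ∀ a, ∃ k, (∀ i, dd i k = 0) ∧ ∃ s, v a = k + delNabla0 u dd s := fun a => by
        have hv : v a ∈ (⨅ j, LinearMap.ker (dd j)) ⊔ LinearMap.range (delNabla0 u dd) := by
          rw [hstd_im, hker]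
          trivial
        obtain ⟨k, hk, _, ⟨s, rfl⟩, h⟩ := Submodule.mem_sup.1 hv
        exact ⟨k, fun i => (Submodule.mem_iInf _).1 hk i, s, h.symm⟩
      choose k hk s hs using this
      refine ⟨k, fun i => funext fun a => hk a i, s, funext fun a => (hs a).trans ?_⟩
      rw [Pi.add_apply]
      congr 1
      exact (connection_euler_apply ι u dd hleib hflat hstd_bij s a).symm)
    (d := d.restrictScalars S) (W := W)
    (LinearMap.ext fun v => (LinearMap.congr_fun hd_sq v).trans (algebraMap_smul R W v))
    (hcomm d) (lam := fun j => (lam j).restrictScalars S) (fun i => hcomm (lam i))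
    (fun i => LinearMap.ext fun v => LinearMap.congr_fun (hlam i) v)
    (C := fun i => LinearMap.pi fun a => ∑ b, C i (dmat d a b) ∘ₗ LinearMap.proj b)
    (fun i v => funext fun a => by
      rw [LinearMap.pi_apply, LinearMap.sum_apply, reduce_apply, Pi.sub_apply]
      change _ = Ideal.Quotient.mk _ (dd i (d v a) - d (fun b => dd i (v b)) a)
      rw [apply_eq_sum_dmat, apply_eq_sum_dmat, map_sum, ← Finset.sum_sub_distrib, map_sum]
      exact Finset.sum_congr rfl fun b _ => hC i (dmat d a b) (v b))
  have hsmul : ∀ (f : Module.End R (ι → R)) v,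
      (((-1 : R) ^ n) • f) v = ((-1) ^ n : ℤ) • f v := fun f v => by
    rw [LinearMap.smul_apply, ← Int.cast_smul_eq_zsmul R]
    simp
  have hlamprod : ∀ v, (List.ofFn fun j => (lam j).restrictScalars S).prod v =
      (List.ofFn lam).prod v := fun v => by
    rw [← prod_map_restrictScalars_apply (S := S), List.map_ofFn]
    rfl
  have hanti : ∀ f : Module.End R (ι → R), (∀ j, ∃ r ∈ Ideal.span (Set.range u),
      lam j * f + f * lam j = r • (1 : Module.End R (ι → R))) → ∀ v,
      reduce S (Ideal.span (Set.range u)) ι (f ((List.ofFn lam).prod v)) = ((-1) ^ n : ℤ) •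
        reduce S (Ideal.span (Set.range u)) ι ((List.ofFn lam).prod (f v)) := fun f hf v => by
    rw [reduce_apply_prod f (List.ofFn lam) (fun g hg => ?_), List.length_ofFn]
    obtain ⟨j, rfl⟩ := (List.mem_ofFn' _ _).1 hg
    exact hf j
  let θ : (ι → R) →ₗ[S] (ι → Q) := ((-1) ^ n : ℤ) •
    (reduce S (Ideal.span (Set.range u)) ι ∘ₗ ((List.ofFn lam).prod).restrictScalars S)
  have hθ : ∀ v, θ v = ((-1) ^ n : ℤ) •
      reduce S (Ideal.span (Set.range u)) ι ((List.ofFn lam).prod v) := fun v => rfl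
  have hθ_anti : ∀ f : Module.End R (ι → R), (∀ j, ∃ r ∈ Ideal.span (Set.range u),
      lam j * f + f * lam j = r • (1 : Module.End R (ι → R))) → ∀ v,
      (matExt (dmat f) : Module.End R (ι → Q)) (θ v) = θ ((((-1 : R) ^ n) • f) v) :=
    fun f hf v => by
      rw [hsmul, map_zsmul, hθ, hθ, map_zsmul]
      congr 1
      exact (matExt_dmat_reduce f _).trans (hanti f hf v)
  refine ⟨ψ, θ, ?_, ?_, ?_, ?_, ⟨H, ?_⟩, ⟨0, ?_⟩⟩
  · refine LinearMap.ext fun x => (hsmul _ _).trans ?_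
    refine hgr ((gX R par).restrictScalars S) (GQ.restrictScalars S) (hcomm _) (fun i => ?_) ?_
      (fun v => matExt_dmat_reduce _ v) x
    · refine LinearMap.ext fun v => funext fun a => ?_
      change (if par a then (-1 : R) else 1) * dd i (v a) =
        dd i ((if par a then (-1 : R) else 1) * v a)
      split_ifs <;> simp
    · refine LinearMap.ext fun v => ?_
      have := LinearMap.congr_fun hd_odd v
      exact (neg_eq_iff_eq_neg.2 this).symm
  · exact LinearMap.ext fun x => (hsmul _ _).trans
      (hch (DQ.restrictScalars S) (fun v => matExt_dmat_reduce _ v) x)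
  · refine LinearMap.ext fun v => hθ_anti (gX R par) (fun j => ⟨0, Ideal.zero_mem _, ?_⟩) v
    rw [hlam_odd, zero_smul, neg_add_cancel]
  · exact LinearMap.ext fun v => hθ_anti d (fun j => ⟨u j, hmem j, hlam j⟩) v
  · refine LinearMap.ext fun v => ?_
    have h := hψθ v
    rw [hlamprod, LinearMap.restrictScalars_apply, ← hsmul, LinearMap.restrictScalars_apply,
      ← hsmul] at h
    exact h
  · refine LinearMap.ext fun x => ?_
    have hθ_red : ∀ y, θ y = ((-1) ^ n : ℤ) • (List.ofFn fun j =>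
        (matExt (dmat (lam j)) : Module.End R (ι → Q))).prod
          (reduce S (Ideal.span (Set.range u)) ι y) := fun y => by
      rw [hθ, ← prod_matExt_dmat_reduce, List.map_ofFn]
      rfl
    have hn : algebraMap ℚ S (((-1 : ℚ) ^ (n * (n - 1) / 2)) / (n.factorial : ℚ)) *
        (n.factorial : S) = (-1) ^ (n * (n - 1) / 2) := by
      rw [← map_natCast (algebraMap ℚ S), ← map_mul,
        div_mul_cancel₀ _ (Nat.cast_ne_zero.2 n.factorial_ne_zero)]
      simp
    have he : e x = algebraMap ℚ S (((-1 : ℚ) ^ (n * (n - 1) / 2)) / (n.factorial : ℚ)) •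
        (List.ofFn fun j => (matExt (dmat (lam j)) : Module.End R (ι → Q))).prod
          (∑ τ : Equiv.Perm (Fin n), (Equiv.Perm.sign τ : ℤ) • (List.ofFn fun kk =>
            (LinearMap.pi fun a => ∑ b, C (τ kk) (dmat d a b) ∘ₗ LinearMap.proj b :
              Module.End S (ι → Q))).prod x) := by
      rw [LinearMap.smul_apply, LinearMap.sum_apply, map_sum]
      congr 1
      exact Finset.sum_congr rfl fun τ _ => by
        rw [map_zsmul]
        rfl
    have hsum : ∀ z : ι → Q, n.factorial • reduce S (Ideal.span (Set.range u)) ι (ψ x) =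
        ((-1) ^ n * (-1) ^ (n * (n - 1) / 2) : ℤ) • z →
        z = ((-1) ^ n * (-1) ^ (n * (n - 1) / 2) : ℤ) • n.factorial •
          reduce S (Ideal.span (Set.range u)) ι (ψ x) := fun z hz => by
      rw [hz, smul_smul, mul_mul_mul_comm, ← mul_pow, ← mul_pow]
      simp
    rw [LinearMap.comp_zero, LinearMap.zero_comp, add_zero, LinearMap.sub_apply,
      LinearMap.zero_apply, sub_eq_zero, LinearMap.comp_apply, hθ_red, he, hsum _ (hθψ x)]
    rw [map_zsmul, map_nsmul, ← Nat.cast_smul_eq_nsmul S, smul_comm (algebraMap ℚ S _),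
      smul_smul (algebraMap ℚ S _), hn, ← Int.cast_smul_eq_zsmul S, ← Int.cast_smul_eq_zsmul S,
      smul_smul, Int.cast_mul, mul_assoc]
    congr 1
    rw [Int.cast_pow, Int.cast_pow, Int.cast_neg, Int.cast_one, ← mul_pow (-1 : S) (-1)]
    simp
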